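/- Equivalent characterizations of normality: with the Hartwig–Spindelböck decomposition data as in the context, assuming K is invertible, with Â^N := Û · fromBlocks(K*Σ₁⁻¹, 0, L*Σ₁⁻¹, 0) · Û* (the NDMPI of Â), A_e := Û · fromBlocks(Σ₁K, Σ₁L, 0, 0) · Û* (the essential part of Â), and A_e^# := Û · fromBlocks(K⁻¹Σ₁⁻¹, K⁻¹Σ₁⁻¹K⁻¹L, 0, 0) · Û* (the group inverse of A_e), the following are equivalent: (i) Â·Â* = Â*·Â; (ii) Â*·A_e^# = A_e^#·Â*; (iii) A_e·Â*·Â^N = Â^N·A_e·Â*; (iv) A_e·A_e^#·Â* = A_e^#·Â*·A_e; (v) Â*·Â·A_e^# = A_e^#·Â*·Â; (vi) Â*·Â^N·A_e^# = A_e^#·Â*·Â^N; (vii) Â*·A_e^#·Â^N = Â^N·Â*·A_e^#. -/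

import Mathlib

open Matrix

/-- The dual complex numbers `𝔻ℂ := ℂ[ε]`, the trivial square-zero extension of `ℂ` by `ℂ`. -/
abbrev DC := TrivSqZeroExt ℂ ℂ

/-- Star on dual complex numbers: `(a + b·ε)* = conj a + conj b · ε`. -/
instance : Star DC :=
  ⟨fun x => ((starRingEnd ℂ) x.fst, (starRingEnd ℂ) x.snd)⟩

/-- A positive appreciable real dual number: the standard part is a positive real and
the dual part is real. -/
def PosAppreciable (x : DC) : Prop :=
  (∃ a : ℝ, 0 < a ∧ x.fst = (a : ℂ)) ∧ (∃ b : ℝ, x.snd = (b : ℂ))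

/-- A nonnegative infinitesimal real dual number: the standard part is `0` and
the dual part is a nonnegative real. -/
def NonnegInfinitesimal (x : DC) : Prop :=
  x.fst = 0 ∧ ∃ b : ℝ, 0 ≤ b ∧ x.snd = (b : ℂ)

/-- The standard part of a dual complex matrix. -/
def stdPart {m n : Type*} (X : Matrix m n DC) : Matrix m n ℂ :=
  X.map TrivSqZeroExt.fst

/-- The dual part of a dual complex matrix. -/
def dualPart {m n : Type*} (X : Matrix m n DC) : Matrix m n ℂ :=
  X.map TrivSqZeroExt.snd

/-- Conjugation makes the dual complex numbers a star ring. -/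
instance : StarRing DC where
  star_involutive x := TrivSqZeroExt.ext (Complex.conj_conj x.fst) (Complex.conj_conj x.snd)
  star_mul x y := by
    refine TrivSqZeroExt.ext ?_ ?_
    · change (starRingEnd ℂ) (x * y).fst = (starRingEnd ℂ) y.fst * (starRingEnd ℂ) x.fst
      simp [mul_comm]
    · rw [TrivSqZeroExt.snd_mul]
      change (starRingEnd ℂ) (x * y).snd =
        (starRingEnd ℂ) y.fst * (starRingEnd ℂ) x.snd + (starRingEnd ℂ) y.snd * (starRingEnd ℂ) x.fst
      simp [mul_comm, add_comm]
  star_add x y := TrivSqZeroExt.ext (map_add (starRingEnd ℂ) x.fst y.fst)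
    (map_add (starRingEnd ℂ) x.snd y.snd)

theorem PosAppreciable.star_eq {x : DC} (hx : PosAppreciable x) : star x = x := by
  obtain ⟨⟨a, -, ha⟩, b, hb⟩ := hx
  refine TrivSqZeroExt.ext ?_ ?_
  · change (starRingEnd ℂ) x.fst = x.fst
    rw [ha, Complex.conj_ofReal]
  · change (starRingEnd ℂ) x.snd = x.snd
    rw [hb, Complex.conj_ofReal]

theorem NonnegInfinitesimal.star_eq {x : DC} (hx : NonnegInfinitesimal x) : star x = x := by
  obtain ⟨ha, b, -, hb⟩ := hx
  refine TrivSqZeroExt.ext ?_ ?_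
  · change (starRingEnd ℂ) x.fst = x.fst
    rw [ha, map_zero]
  · change (starRingEnd ℂ) x.snd = x.snd
    rw [hb, Complex.conj_ofReal]

theorem PosAppreciable.add {x y : DC} (hx : PosAppreciable x) (hy : PosAppreciable y) :
    PosAppreciable (x + y) := by
  obtain ⟨⟨a, ha, hxa⟩, b, hxb⟩ := hx
  obtain ⟨⟨c, hc, hyc⟩, d, hyd⟩ := hy
  exact ⟨⟨a + c, add_pos ha hc, by simp [hxa, hyc]⟩, b + d, by simp [hxb, hyd]⟩

theorem PosAppreciable.isUnit {x : DC} (hx : PosAppreciable x) : IsUnit x := by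
  obtain ⟨⟨a, ha, hxa⟩, -⟩ := hx
  rw [TrivSqZeroExt.isUnit_iff_isUnit_fst, hxa, isUnit_iff_ne_zero]
  exact_mod_cast ha.ne'

theorem NonnegInfinitesimal.mul_eq_zero {x y : DC} (hx : NonnegInfinitesimal x)
    (hy : NonnegInfinitesimal y) : x * y = 0 := by
  ext <;> simp [hx.1, hy.1]

/-- A matrix commuting with the square of a diagonal matrix commutes with the diagonal matrix
itself, provided that the sums of diagonal entries are units. -/
theorem Matrix.commute_diagonal_of_sq {R m : Type*} [CommRing R] [Fintype m] [DecidableEq m]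
    {d : m → R} (hd : ∀ i j, IsUnit (d i + d j)) {K : Matrix m m R}
    (h : diagonal d * (diagonal d * K) = K * (diagonal d * diagonal d)) :
    diagonal d * K = K * diagonal d := by
  ext i j
  have hij := congrFun (congrFun h i) j
  rw [← Matrix.mul_assoc K] at hij
  simp only [diagonal_mul, mul_diagonal] at hij ⊢
  refine (hd i j).mul_left_cancel ?_
  linear_combination hij

theorem Matrix.mul_mul_of_mul_eq_one {R m n : Type*} [Semiring R] [Fintype m] [DecidableEq m]
    {A B : Matrix m m R} (h : A * B = 1) (X : Matrix m n R) : A * (B * X) = X := by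
  rw [← Matrix.mul_assoc, h, Matrix.one_mul]

section Blocks

variable {R m n : Type*} [CommRing R] [StarRing R] [Fintype m] [DecidableEq m]
  [Fintype n] [DecidableEq n]

/-- The block form of the equivalent characterizations of normality, for a diagonal factor
`diag(S, S₂)` such that `S₂ X S₂ = 0` for all `X`. -/
theorem normal_tfae_blocks {K J S T : Matrix m m R} {L : Matrix m n R} {M : Matrix n m R}
    {N S₂ : Matrix n n R} (hKJ : K * J = 1)
    (hST : S * T = 1) (hS : Sᴴ = S)
    (hS₂ : S₂ᴴ = S₂) (hS₂' : ∀ X : Matrix n n R, S₂ * X * S₂ = 0)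
    (hKL : K * Kᴴ + L * Lᴴ = 1) (hKM : K * Mᴴ + L * Nᴴ = 0)
    (hSK : S * (S * K) = K * (S * S) → S * K = K * S)
    {A AN Ae Aeg : Matrix (m ⊕ n) (m ⊕ n) R}
    (hA : A = fromBlocks (S * K) (S * L) (S₂ * M) (S₂ * N))
    (hAN : AN = fromBlocks (Kᴴ * T) 0 (Lᴴ * T) 0)
    (hAe : Ae = fromBlocks (S * K) (S * L) 0 0)
    (hAeg : Aeg = fromBlocks (J * T) (J * T * J * L) 0 0) :
    [A * Aᴴ = Aᴴ * A,
     Aᴴ * Aeg = Aeg * Aᴴ,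
     Ae * Aᴴ * AN = AN * Ae * Aᴴ,
     Ae * Aeg * Aᴴ = Aeg * Aᴴ * Ae,
     Aᴴ * A * Aeg = Aeg * Aᴴ * A,
     Aᴴ * AN * Aeg = Aeg * Aᴴ * AN,
     Aᴴ * Aeg * AN = AN * Aᴴ * Aeg].TFAE := by
  have hJK : J * K = 1 := mul_eq_one_comm.mp hKJ
  have hTS : T * S = 1 := mul_eq_one_comm.mp hST
  have hKJ' (X : Matrix m m R) : K * (J * X) = X := mul_mul_of_mul_eq_one hKJ X
  have hJK' (X : Matrix m m R) : J * (K * X) = X := mul_mul_of_mul_eq_one hJK X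
  have hST' (X : Matrix m m R) : S * (T * X) = X := mul_mul_of_mul_eq_one hST X
  have hTS' (X : Matrix m m R) : T * (S * X) = X := mul_mul_of_mul_eq_one hTS X
  have hJKstar : Jᴴ * Kᴴ = 1 := by rw [← conjTranspose_mul, hKJ, conjTranspose_one]
  have hKJstar : Kᴴ * Jᴴ = 1 := mul_eq_one_comm.mp hJKstar
  have hS₂S₂ : S₂ * S₂ = 0 := by simpa using hS₂' 1
  have hS₂M : S₂ * (S₂ * M) = 0 := by rw [← Matrix.mul_assoc, hS₂S₂, Matrix.zero_mul]
  have hS₂N : S₂ * (S₂ * N) = 0 := by rw [← Matrix.mul_assoc, hS₂S₂, Matrix.zero_mul]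
  have hMK : M * Kᴴ + N * Lᴴ = 0 := by
    simpa [conjTranspose_add, conjTranspose_mul] using congrArg conjTranspose hKM
  have hzero (h : Lᴴ = 0) : L = 0 := conjTranspose_eq_zero.mp h
  have hJ (h : L = 0) : Kᴴ = J := by
    have := congrArg (J * ·) hKL
    simpa [h, Matrix.mul_add, hJK'] using this
  have hM (h : L = 0) : M = 0 := by
    have := congrArg (· * Jᴴ) hMK
    simpa [h, Matrix.mul_assoc, hKJstar] using this
  have hS₂MM : S₂ * (M * (Mᴴ * S₂)) = 0 := by
    rw [← Matrix.mul_assoc M, ← Matrix.mul_assoc, hS₂']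
  have hS₂NN : S₂ * (N * (Nᴴ * S₂)) = 0 := by
    rw [← Matrix.mul_assoc N, ← Matrix.mul_assoc, hS₂']
  have back (h : L = 0 ∧ S * K = K * S) :
      A * Aᴴ = Aᴴ * A ∧ Aᴴ * Aeg = Aeg * Aᴴ ∧ Ae * Aᴴ * AN = AN * Ae * Aᴴ ∧
      Ae * Aeg * Aᴴ = Aeg * Aᴴ * Ae ∧ Aᴴ * A * Aeg = Aeg * Aᴴ * A ∧
      Aᴴ * AN * Aeg = Aeg * Aᴴ * AN ∧ Aᴴ * Aeg * AN = AN * Aᴴ * Aeg := by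
    obtain ⟨hL, hC⟩ := h
    have hM := hM hL
    have hJ := hJ hL
    have hSJ : S * J = J * S := by
      have := congrArg (fun X => J * X * J) hC
      simpa [Matrix.mul_assoc, hKJ, hJK'] using this.symm
    have hTK : T * K = K * T := by
      have := congrArg (fun X => T * X * T) hC
      simpa [Matrix.mul_assoc, hST, hTS'] using this.symm
    have hTJ : T * J = J * T := by
      have := congrArg (fun X => T * X * T) hSJ
      simpa [Matrix.mul_assoc, hST, hTS'] using this.symm
    have hC' (X : Matrix m m R) : S * (K * X) = K * (S * X) := by
      rw [← Matrix.mul_assoc, hC, Matrix.mul_assoc]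
    have hSJ' (X : Matrix m m R) : S * (J * X) = J * (S * X) := by
      rw [← Matrix.mul_assoc, hSJ, Matrix.mul_assoc]
    have hTK' (X : Matrix m m R) : T * (K * X) = K * (T * X) := by
      rw [← Matrix.mul_assoc, hTK, Matrix.mul_assoc]
    have hTJ' (X : Matrix m m R) : T * (J * X) = J * (T * X) := by
      rw [← Matrix.mul_assoc, hTJ, Matrix.mul_assoc]
    refine ⟨?_, ?_, ?_, ?_, ?_, ?_, ?_⟩ <;>
    simp [hA, hAN, hAe, hAeg, hL, hM, hJ, hS, hS₂, hS₂N, hS₂NN, fromBlocks_conjTranspose,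
      fromBlocks_multiply, Matrix.mul_assoc, hC, hC', hSJ, hSJ', hTK', hTJ, hTJ', hKJ, hKJ',
      hJK, hJK', hST, hTS]
  have key (hL : L = 0) (h : L = 0 → Kᴴ = J → M = 0 → S * (S * K) = K * (S * S)) :
      L = 0 ∧ S * K = K * S := ⟨hL, hSK (h hL (hJ hL) (hM hL))⟩
  have hKLS : K * (Kᴴ * S) + L * (Lᴴ * S) = S := by
    rw [← Matrix.mul_assoc, ← Matrix.mul_assoc, ← Matrix.add_mul, hKL, Matrix.one_mul]
  have hKMS : K * (Mᴴ * S₂) + L * (Nᴴ * S₂) = 0 := by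
    rw [← Matrix.mul_assoc, ← Matrix.mul_assoc, ← Matrix.add_mul, hKM, Matrix.zero_mul]
  have hMKS : M * (Kᴴ * S) + N * (Lᴴ * S) = 0 := by
    rw [← Matrix.mul_assoc, ← Matrix.mul_assoc, ← Matrix.add_mul, hMK, Matrix.zero_mul]
  have hJLS : Kᴴ * S + J * (L * (Lᴴ * S)) = J * S := by
    rw [← hJK' (Kᴴ * S), ← Matrix.mul_add, hKLS]
  have hJLS₂ : Mᴴ * S₂ + J * (L * (Nᴴ * S₂)) = 0 := by
    rw [← mul_mul_of_mul_eq_one hJK (Mᴴ * S₂), ← Matrix.mul_add, hKMS, Matrix.mul_zero]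
  have hJLT : Kᴴ * T + J * (L * (Lᴴ * T)) = J * T := by
    rw [← hJK' (Kᴴ * T), ← Matrix.mul_add, ← Matrix.mul_assoc K, ← Matrix.mul_assoc L,
      ← Matrix.add_mul, hKL, Matrix.one_mul]
  have hAAstar : A * Aᴴ = fromBlocks (S * S) 0 0 0 := by
    simp [hA, hS, hS₂, hS₂MM, hS₂NN, fromBlocks_conjTranspose, fromBlocks_multiply, Matrix.mul_assoc,
      ← Matrix.mul_add, hKLS, hKMS, hMKS]
  have hAstarA : Aᴴ * A = fromBlocks (Kᴴ * (S * (S * K))) (Kᴴ * (S * (S * L)))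
      (Lᴴ * (S * (S * K))) (Lᴴ * (S * (S * L))) := by
    simp [hA, hS, hS₂, hS₂M, hS₂N, fromBlocks_conjTranspose, fromBlocks_multiply, Matrix.mul_assoc]
  have hAeAstar : Ae * Aᴴ = fromBlocks (S * S) 0 0 0 := by
    simp [hA, hAe, hS, hS₂, fromBlocks_conjTranspose, fromBlocks_multiply, Matrix.mul_assoc,
      ← Matrix.mul_add, hKLS, hKMS]
  have hAegAstar : Aeg * Aᴴ = fromBlocks (J * (T * (J * S))) 0 0 0 := by
    simp [hA, hAeg, hS, hS₂, fromBlocks_conjTranspose, fromBlocks_multiply, Matrix.mul_assoc,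
      ← Matrix.mul_add, hJLS, hJLS₂]
  have hAegAN : Aeg * AN = fromBlocks (J * (T * (J * T))) 0 0 0 := by
    simp [hAeg, hAN, fromBlocks_multiply, Matrix.mul_assoc, ← Matrix.mul_add, hJLT]
  have hAstarAeg : Aᴴ * Aeg = fromBlocks (Kᴴ * (S * (J * T))) (Kᴴ * (S * (J * (T * (J * L)))))
      (Lᴴ * (S * (J * T))) (Lᴴ * (S * (J * (T * (J * L))))) := by
    simp [hA, hAeg, hS, hS₂, fromBlocks_conjTranspose, fromBlocks_multiply, Matrix.mul_assoc]
  tfae_have 1 → 2 := fun h => by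
    rw [hAAstar, hAstarA, fromBlocks_inj] at h
    obtain ⟨h₁, h₂, -⟩ := h
    have hL : L = 0 := by
      have := congrArg (fun X => T * (T * (Jᴴ * X))) h₂
      simpa [mul_mul_of_mul_eq_one hJKstar, mul_mul_of_mul_eq_one hTS] using this.symm
    refine (back (key hL fun _ hJ _ => ?_)).2.1
    have := congrArg (K * ·) h₁
    simpa [hJ, hKJ'] using this.symm
  tfae_have 2 → 3 := fun h => by
    rw [hAegAstar, hAstarAeg, fromBlocks_inj] at h
    obtain ⟨h₁, -, h₂, -⟩ := h
    have hL : L = 0 := by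
      refine hzero ?_
      have := congrArg (fun X => X * S * K * T) h₂
      simpa [Matrix.mul_assoc, hTS', hJK', hST] using this
    refine (back (key hL fun _ hJ _ => ?_)).2.2.1
    have := congrArg (fun X => K * (S * (K * (X * S * K)))) h₁
    simpa [hJ, Matrix.mul_assoc, hKJ', hST', hTS', hJK, hKJ] using this.symm
  tfae_have 3 → 4 := fun h => by
    rw [Matrix.mul_assoc AN, hAeAstar, hAN, fromBlocks_multiply, fromBlocks_multiply,
      fromBlocks_inj] at h
    obtain ⟨h₁, -, h₂, -⟩ := h
    have hL : L = 0 := by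
      refine hzero ?_
      have := congrArg (fun X => X * T) h₂
      simpa [Matrix.mul_assoc, hTS', hST] using this.symm
    refine (back (key hL fun _ hJ _ => ?_)).2.2.2.1
    have := congrArg (fun X => K * (X * S * K)) h₁
    simpa [hL, hJ, Matrix.mul_assoc, hKJ', hTS', hJK, hTS] using this.symm
  tfae_have 4 → 5 := fun h => by
    have hl : Ae * Aeg * Aᴴ = fromBlocks (J * S) 0 0 0 := by
      rw [Matrix.mul_assoc, hAegAstar]
      simp [hAe, fromBlocks_multiply, Matrix.mul_assoc, hKJ', hST']
    rw [hl, hAegAstar, hAe, fromBlocks_multiply, fromBlocks_inj] at h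
    obtain ⟨h₁, h₂, -⟩ := h
    have hL : L = 0 := by
      have := congrArg (fun X => T * (T * (K * (S * (K * X))))) h₂
      simpa [Matrix.mul_assoc, mul_mul_of_mul_eq_one hKJ, mul_mul_of_mul_eq_one hST,
        mul_mul_of_mul_eq_one hTS] using this.symm
    refine (back (key hL fun _ hJ _ => ?_)).2.2.2.2.1
    have := congrArg (fun X => K * (S * (K * X))) h₁
    simpa [hL, hJ, Matrix.mul_assoc, hKJ', hST'] using this.symm
  tfae_have 5 → 6 := fun h => by
    rw [hAegAstar, hAstarA, hA, hAeg, fromBlocks_multiply, fromBlocks_multiply,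
      fromBlocks_inj] at h
    obtain ⟨h₁, -, h₂, -⟩ := h
    have hL : L = 0 := by
      refine hzero ?_
      have := congrArg (fun X => X * T) h₂
      simpa [Matrix.mul_assoc, hKJ', hST] using this
    refine (back (key hL fun _ hJ _ => ?_)).2.2.2.2.2.1
    have := congrArg (fun X => K * (S * (K * X))) h₁
    simpa [hL, hJ, Matrix.mul_assoc, hKJ', hST', hST] using this.symm
  tfae_have 6 → 7 := fun h => by
    rw [hAegAstar, hA, hAN, hAeg, fromBlocks_conjTranspose] at h
    simp only [fromBlocks_multiply, fromBlocks_inj] at h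
    obtain ⟨h₁, -, h₂, -⟩ := h
    have h₃ : Lᴴ = -(Nᴴ * (S₂ * (Lᴴ * (Jᴴ * T)))) := by
      have := congrArg (fun X => X * S * K * S * Jᴴ * T) h₂
      rw [eq_neg_iff_add_eq_zero]
      simpa [hS, hS₂, Matrix.mul_assoc, Matrix.add_mul, hTS', hJK', hST,
        mul_mul_of_mul_eq_one hKJstar] using this
    have hL : L = 0 := by
      refine hzero ?_
      have h₄ : S₂ * Lᴴ = 0 := by
        rw [h₃, Matrix.mul_neg, ← Matrix.mul_assoc Nᴴ, ← Matrix.mul_assoc S₂, ← Matrix.mul_assoc S₂,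
          hS₂', Matrix.zero_mul, neg_zero]
      rw [h₃, ← Matrix.mul_assoc S₂, h₄]
      simp
    refine (back (key hL fun _ hJ hM => ?_)).2.2.2.2.2.2
    have := congrArg (fun X => K * (S * (K * (X * S * K * S * K)))) h₁
    simpa [hL, hM, hJ, hS, Matrix.mul_assoc, hKJ', hST', hTS', hJK', hJK] using this.symm
  tfae_have 7 → 1 := fun h => by
    rw [Matrix.mul_assoc, Matrix.mul_assoc AN, hAegAN, hAstarAeg, hA, hAN, fromBlocks_conjTranspose] at h
    simp only [fromBlocks_multiply, fromBlocks_inj] at h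
    obtain ⟨h₁, h₂, -⟩ := h
    have hL : L = 0 := by
      have := congrArg (fun X => K * (S * (K * (T * (Jᴴ * (S * (Jᴴ * X))))))) h₂
      simpa [Matrix.mul_assoc, mul_mul_of_mul_eq_one hKJ, mul_mul_of_mul_eq_one hST,
        mul_mul_of_mul_eq_one hTS, mul_mul_of_mul_eq_one hJKstar] using this.symm
    refine (back (key hL fun _ hJ _ => ?_)).1
    have := congrArg (fun X => K * (S * (K * (X * S * K * S * K)))) h₁
    simpa [hL, hJ, hS, Matrix.mul_assoc, hKJ', hST', hTS', hJK', hJK] using this.symm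
  tfae_finish


end Blocks

/-- Equivalent characterizations of normality. -/
theorem normal_tfae
    {r s : ℕ}
    -- `Û`, a unitary matrix
    (U : Matrix (Fin r ⊕ Fin s) (Fin r ⊕ Fin s) DC)
    (hU₁ : U * Uᴴ = 1) (hU₂ : Uᴴ * U = 1)
    -- the blocks `K, L, M, N` forming a unitary block matrix
    (K : Matrix (Fin r) (Fin r) DC) (L : Matrix (Fin r) (Fin s) DC)
    (M : Matrix (Fin s) (Fin r) DC) (N : Matrix (Fin s) (Fin s) DC)
    (hW₁ : fromBlocks K L M N * (fromBlocks K L M N)ᴴ = 1)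
    (hW₂ : (fromBlocks K L M N)ᴴ * fromBlocks K L M N = 1)
    -- `Σ₁` diagonal with positive appreciable real dual diagonal entries
    (S₁ : Matrix (Fin r) (Fin r) DC) (d₁ : Fin r → DC)
    (hS₁ : S₁ = Matrix.diagonal d₁) (hd₁ : ∀ i, PosAppreciable (d₁ i))
    -- `Σ₂` diagonal with nonnegative infinitesimal real dual diagonal entries
    (S₂ : Matrix (Fin s) (Fin s) DC) (d₂ : Fin s → DC)
    (hS₂ : S₂ = Matrix.diagonal d₂) (hd₂ : ∀ i, NonnegInfinitesimal (d₂ i))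
    -- the Hartwig–Spindelböck decomposition of `Â`
    (A : Matrix (Fin r ⊕ Fin s) (Fin r ⊕ Fin s) DC)
    (hA : A = U * fromBlocks (S₁ * K) (S₁ * L) (S₂ * M) (S₂ * N) * Uᴴ)
    -- `Â^N`, the NDMPI of `Â`
    (AN : Matrix (Fin r ⊕ Fin s) (Fin r ⊕ Fin s) DC)
    (hAN : AN = U * fromBlocks (Kᴴ * S₁⁻¹) 0 (Lᴴ * S₁⁻¹) 0 * Uᴴ)
    -- `A_e`, the essential part of `Â`
    (Ae : Matrix (Fin r ⊕ Fin s) (Fin r ⊕ Fin s) DC)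
    (hAe : Ae = U * fromBlocks (S₁ * K) (S₁ * L) 0 0 * Uᴴ)
    -- `K` is invertible
    (hK : IsUnit K)
    -- `A_e^#`, the group inverse of the essential part
    (Aeg : Matrix (Fin r ⊕ Fin s) (Fin r ⊕ Fin s) DC)
    (hAeg : Aeg = U * fromBlocks (K⁻¹ * S₁⁻¹) (K⁻¹ * S₁⁻¹ * K⁻¹ * L) 0 0 * Uᴴ) :
    [A * Aᴴ = Aᴴ * A,
     Aᴴ * Aeg = Aeg * Aᴴ,
     Ae * Aᴴ * AN = AN * Ae * Aᴴ,
     Ae * Aeg * Aᴴ = Aeg * Aᴴ * Ae,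
     Aᴴ * A * Aeg = Aeg * Aᴴ * A,
     Aᴴ * AN * Aeg = Aeg * Aᴴ * AN,
     Aᴴ * Aeg * AN = AN * Aᴴ * Aeg].TFAE := by
  obtain ⟨J, hJK⟩ := hK.exists_left_inv
  have hKJ : K * J = 1 := mul_eq_one_comm.mp hJK
  have hS₁det : IsUnit S₁ := by
    rw [hS₁, Matrix.isUnit_diagonal, Pi.isUnit_iff]
    exact fun i => (hd₁ i).isUnit
  have hST : S₁ * S₁⁻¹ = 1 := Matrix.mul_nonsing_inv _ ((Matrix.isUnit_iff_isUnit_det _).mp hS₁det)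
  rw [Matrix.inv_eq_right_inv hKJ] at hAeg
  rw [fromBlocks_conjTranspose, fromBlocks_multiply, ← fromBlocks_one, fromBlocks_inj] at hW₁
  have hmul (X Y : Matrix (Fin r ⊕ Fin s) (Fin r ⊕ Fin s) DC) :
      U * X * Uᴴ * (U * Y * Uᴴ) = U * (X * Y) * Uᴴ := by
    simp only [Matrix.mul_assoc, mul_mul_of_mul_eq_one hU₂]
  have hinj (X Y : Matrix (Fin r ⊕ Fin s) (Fin r ⊕ Fin s) DC) :
      U * X * Uᴴ = U * Y * Uᴴ ↔ X = Y := by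
    refine ⟨fun h => ?_, fun h => by rw [h]⟩
    have := congrArg (fun Z => Uᴴ * (Z * U)) h
    simpa only [Matrix.mul_assoc, hU₂, mul_mul_of_mul_eq_one hU₂, Matrix.mul_one] using this
  have hstar (X : Matrix (Fin r ⊕ Fin s) (Fin r ⊕ Fin s) DC) :
      (U * X * Uᴴ)ᴴ = U * Xᴴ * Uᴴ := by
    simp only [conjTranspose_mul, conjTranspose_conjTranspose, Matrix.mul_assoc]
  simp only [hA, hAN, hAe, hAeg, hstar, hmul, hinj]
  refine normal_tfae_blocks hKJ hST ?_ ?_ ?_ hW₁.1 hW₁.2.1 ?_ rfl rfl rfl rfl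
  · rw [hS₁, diagonal_conjTranspose]
    exact congrArg diagonal (funext fun i => (hd₁ i).star_eq)
  · rw [hS₂, diagonal_conjTranspose]
    exact congrArg diagonal (funext fun i => (hd₂ i).star_eq)
  · intro X
    ext1 i j
    rw [hS₂, mul_diagonal, diagonal_mul, mul_right_comm, (hd₂ i).mul_eq_zero (hd₂ j), zero_mul]
    rfl
  · rw [hS₁]
    exact commute_diagonal_of_sq fun i j => ((hd₁ i).add (hd₁ j)).isUnit
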